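/- arXiv:2208.09593 — 3 statements merged into one kernel-verified Lean document; each statement's English description precedes it below -/
import Mathlib

section
/- The integral from 0 to 1 of arctan(x)³ dx equals π³/64 + (3/32)·π²·log 2 − (3/4)·π·G + (63/64)·ζ(3), where G is Catalan's constant and ζ is the Riemann zeta function. -/
open Real

/-- Catalan's constant. -/
noncomputable def catalanConst : ℝ := ∑' n : ℕ, (-1 : ℝ) ^ n / (2 * (n : ℝ) + 1) ^ 2

/-- `ζ(3) = ∑_{n≥1} 1/n³`. -/
noncomputable def zeta3 : ℝ := ∑' n : ℕ, 1 / ((n : ℝ) + 1) ^ 3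

open Filter Topology intervalIntegral

/-- The alternating harmonic series sums to `log 2`, by Abel's limit theorem. -/
theorem tendsto_alternating_harmonic_log_two :
    Tendsto (fun N : ℕ => ∑ m ∈ Finset.range N, (-1 : ℝ) ^ m / ((m : ℝ) + 1)) atTop
      (𝓝 (log 2)) := by
  obtain ⟨l, h⟩ : ∃ l, Tendsto
      (fun N : ℕ => ∑ m ∈ Finset.range N, (-1 : ℝ) ^ m / ((m : ℝ) + 1)) atTop (𝓝 l) := by
    simp_rw [div_eq_mul_one_div ((-1 : ℝ) ^ _)]
    apply Antitone.tendsto_alternating_series_of_tendsto_zero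
    · exact fun a b hab => by gcongr
    · exact tendsto_one_div_add_atTop_nhds_zero_nat
  have m : 𝓝[<] (1 : ℝ) ≤ 𝓝 1 := nhdsWithin_le_nhds
  have abel := (Real.tendsto_tsum_powerSeries_nhdsWithin_lt h).mul m
  have hlog : Tendsto (fun x : ℝ => log (1 + x)) (𝓝[<] 1) (𝓝 l) := by
    rw [mul_one] at abel
    apply abel.congr'
    filter_upwards [Ioo_mem_nhdsLT (show (0 : ℝ) < 1 by norm_num)] with x hx
    have hs := (hasSum_pow_div_log_of_abs_lt_one (x := -x)
      (by rw [abs_neg, abs_lt]; constructor <;> linarith [hx.1, hx.2])).neg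
    rw [neg_neg, sub_neg_eq_add] at hs
    rw [← hs.tsum_eq, ← tsum_mul_right]
    refine tsum_congr fun n => ?_
    rw [neg_pow x (n + 1)]
    ring
  have hcont : Tendsto (fun x : ℝ => log (1 + x)) (𝓝[<] 1) (𝓝 (log (1 + 1))) :=
    ((continuousAt_const.add continuousAt_id).log (by norm_num)).tendsto.mono_left m
  rw [tendsto_nhds_unique hlog hcont] at h
  norm_num at h ⊢
  exact h

theorem hasSum_zeta3 : HasSum (fun n : ℕ => 1 / ((n : ℝ) + 1) ^ 3) zeta3 := by
  have h := (summable_nat_add_iff 1).2 (Real.summable_one_div_nat_pow (p := 3).2 (by norm_num))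
  push_cast at h
  exact h.hasSum

theorem hasSum_odd_cubes :
    HasSum (fun n : ℕ => 1 / (2 * (n : ℝ) + 1) ^ 3) (7 / 8 * zeta3) := by
  have hinj : Function.Injective (fun n : ℕ => 2 * n) := fun a b h => by simpa using h
  have hodd := (hasSum_zeta3.summable.comp_injective hinj).hasSum
  have heven : HasSum (fun n : ℕ => 1 / (((2 * n + 1 : ℕ) : ℝ) + 1) ^ 3) (zeta3 / 8) := by
    refine (hasSum_zeta3.div_const 8).congr_fun ?_
    intro n
    push_cast
    rw [show (2 * (n : ℝ) + 1 + 1) = 2 * (n + 1) by ring, mul_pow]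
    field_simp
    norm_num
  have hsum := (HasSum.even_add_odd (f := fun n : ℕ => 1 / ((n : ℝ) + 1) ^ 3) hodd heven).unique
    hasSum_zeta3
  rw [eq_sub_of_add_eq hsum, show zeta3 - zeta3 / 8 = 7 / 8 * zeta3 by ring] at hodd
  exact hodd.congr_fun fun n => by simp

theorem hasSum_alternating_cubes :
    HasSum (fun n : ℕ => (-1 : ℝ) ^ n / ((n : ℝ) + 1) ^ 3) (3 / 4 * zeta3) := by
  have h := HasSum.even_add_odd (f := fun n : ℕ => (-1 : ℝ) ^ n / ((n : ℝ) + 1) ^ 3)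
    (m := 7 / 8 * zeta3) (m' := -(zeta3 / 8))
    (hasSum_odd_cubes.congr_fun fun n => by simp)
    ((hasSum_zeta3.div_const 8).neg.congr_fun fun n => by
      push_cast
      rw [show (2 * (n : ℝ) + 1 + 1) = 2 * (n + 1) by ring, mul_pow, pow_succ, pow_mul]
      field_simp
      norm_num)
  convert h using 1
  ring

theorem hasSum_catalanConst :
    HasSum (fun n : ℕ => (-1 : ℝ) ^ n / (2 * (n : ℝ) + 1) ^ 2) catalanConst := by
  refine Summable.hasSum (Summable.of_norm ?_)
  have hinj : Function.Injective (fun n : ℕ => 2 * n + 1) := fun a b h => by simpa using h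
  refine ((Real.summable_one_div_nat_pow (p := 2).2 (by norm_num)).comp_injective hinj).congr ?_
  intro n
  simp [abs_of_nonneg (by positivity : (0 : ℝ) ≤ 2 * n + 1)]

/-- **Riemann–Lebesgue lemma** for continuously differentiable functions and the sine. -/
theorem tendsto_integral_mul_sin_atTop {g g' : ℝ → ℝ} {a b : ℝ} (hab : a ≤ b)
    (hg : ∀ t ∈ Set.Icc a b, HasDerivAt g (g' t) t) (hg' : ContinuousOn g' (Set.Icc a b)) :
    Tendsto (fun c : ℝ => ∫ t in a..b, g t * sin (c * t)) atTop (𝓝 0) := by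
  rw [← Set.uIcc_of_le hab] at hg hg'
  have key : ∀ c : ℝ, 0 < c → ∫ t in a..b, g t * sin (c * t) =
      (g a * cos (c * a) - g b * cos (c * b) + ∫ t in a..b, g' t * cos (c * t)) / c := by
    intro c hc
    have hv : ∀ t ∈ Set.uIcc a b, HasDerivAt (fun t => -(cos (c * t) / c)) (sin (c * t)) t := by
      intro t _
      have h := ((((hasDerivAt_id t).const_mul c).cos).div_const c).neg
      refine h.congr_deriv ?_
      simp only [id, mul_one]
      field_simp
    rw [integral_mul_deriv_eq_deriv_mul hg hv hg'.intervalIntegrable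
      (Continuous.intervalIntegrable (by fun_prop) _ _)]
    have : ∀ t, g' t * -(cos (c * t) / c) = (-1 / c) * (g' t * cos (c * t)) := fun t => by ring
    simp_rw [this, intervalIntegral.integral_const_mul]
    ring
  have hbound : ∀ c : ℝ, |g a * cos (c * a) - g b * cos (c * b) +
      ∫ t in a..b, g' t * cos (c * t)| ≤ |g a| + |g b| + ∫ t in a..b, |g' t| := by
    intro c
    have hmul : ∀ x y : ℝ, |x * cos y| ≤ |x| := fun x y => by
      rw [abs_mul]
      exact mul_le_of_le_one_right (abs_nonneg _) (abs_cos_le_one _)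
    have hint : ‖∫ t in a..b, g' t * cos (c * t)‖ ≤ ∫ t in a..b, |g' t| :=
      norm_integral_le_of_norm_le hab (Eventually.of_forall fun t _ => hmul _ _)
        hg'.abs.intervalIntegrable
    calc _ ≤ |g a * cos (c * a)| + |g b * cos (c * b)| + |∫ t in a..b, g' t * cos (c * t)| :=
          (abs_add_le _ _).trans (by gcongr; exact abs_sub _ _)
      _ ≤ _ := add_le_add (add_le_add (hmul _ _) (hmul _ _)) hint
  refine squeeze_zero_norm' ?_
    (tendsto_const_nhds (x := |g a| + |g b| + ∫ t in a..b, |g' t|) |>.div_atTop tendsto_id)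
  filter_upwards [eventually_gt_atTop 0] with c hc
  rw [key c hc, norm_div, norm_of_nonneg hc.le]
  exact div_le_div_of_nonneg_right (hbound c) hc.le

theorem integral_sq_mul_sin {c : ℝ} (hc : c ≠ 0) (b : ℝ) :
    ∫ t in (0 : ℝ)..b, t ^ 2 * sin (c * t) =
      -(b ^ 2 * cos (c * b) / c) + 2 * b * sin (c * b) / c ^ 2 + 2 * cos (c * b) / c ^ 3
        - 2 / c ^ 3 := by
  have hderiv : ∀ t ∈ Set.uIcc 0 b, HasDerivAt (fun t => -(t ^ 2 * cos (c * t) / c)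
      + 2 * t * sin (c * t) / c ^ 2 + 2 * cos (c * t) / c ^ 3) (t ^ 2 * sin (c * t)) t := by
    intro t _
    have hl := (hasDerivAt_id' t).const_mul c
    have h := ((((hasDerivAt_pow 2 t).mul hl.cos).div_const c).neg.add
      ((((hasDerivAt_id' t).const_mul 2).mul hl.sin).div_const (c ^ 2))).add
      ((hl.cos.const_mul 2).div_const (c ^ 3))
    refine h.congr_deriv ?_
    field_simp
    ring
  rw [integral_eq_sub_of_hasDerivAt hderiv (Continuous.intervalIntegrable (by fun_prop) _ _)]
  simp

/-- The alternating sine sums approximate the tangent, with an explicit oscillating remainder. -/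
theorem sum_sin_eq_tan_sub {t : ℝ} (ht : cos t ≠ 0) (N : ℕ) :
    ∑ m ∈ Finset.range N, (2 * sin ((4 * m + 2) * t) - 2 * sin ((4 * m + 4) * t)) =
      tan t - sin ((4 * N + 1) * t) / cos t := by
  induction N with
  | zero => simp [tan_eq_sin_div_cos]
  | succ N ih =>
    rw [Finset.sum_range_succ, ih]
    have e1 : sin ((4 * N + 1) * t) = sin ((4 * N + 2) * t) * cos t
        - cos ((4 * N + 2) * t) * sin t := by rw [← sin_sub]; ring_nf
    have e2 : sin ((4 * N + 3) * t) = sin ((4 * N + 2) * t) * cos t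
        + cos ((4 * N + 2) * t) * sin t := by rw [← sin_add]; ring_nf
    have e3 : sin ((4 * N + 3) * t) = sin ((4 * N + 4) * t) * cos t
        - cos ((4 * N + 4) * t) * sin t := by rw [← sin_sub]; ring_nf
    have e4 : sin ((4 * (N + 1 : ℕ) + 1) * t) = sin ((4 * N + 4) * t) * cos t
        + cos ((4 * N + 4) * t) * sin t := by rw [← sin_add]; push_cast; ring_nf
    have hstep : sin ((4 * (N + 1 : ℕ) + 1) * t) = sin ((4 * N + 1) * t)
        - (2 * sin ((4 * N + 2) * t) - 2 * sin ((4 * N + 4) * t)) * cos t := by linarith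
    rw [hstep, sub_div, mul_div_cancel_right₀ _ ht]
    ring

theorem cos_pos_of_mem_Icc_zero_pi_div_four {t : ℝ} (ht : t ∈ Set.Icc 0 (π / 4)) : 0 < cos t :=
  cos_pos_of_mem_Ioo ⟨by linarith [ht.1, pi_pos], by linarith [ht.2, pi_pos]⟩

theorem continuousOn_sq_mul_tan :
    ContinuousOn (fun t : ℝ => t ^ 2 * tan t) (Set.Icc 0 (π / 4)) :=
  (continuousOn_id.pow 2).mul
    (continuousOn_tan.mono fun _ ht => (cos_pos_of_mem_Icc_zero_pi_div_four ht).ne')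

theorem tendsto_integral_sq_div_cos_mul_sin :
    Tendsto (fun c : ℝ => ∫ t in (0 : ℝ)..(π / 4), t ^ 2 / cos t * sin (c * t)) atTop (𝓝 0) := by
  refine tendsto_integral_mul_sin_atTop
    (g' := fun t => (2 * t * cos t + t ^ 2 * sin t) / cos t ^ 2) (by positivity) ?_ ?_
  · intro t ht
    have h := (hasDerivAt_pow 2 t).div (hasDerivAt_cos t)
      (cos_pos_of_mem_Icc_zero_pi_div_four ht).ne'
    refine h.congr_deriv ?_
    push_cast
    ring
  · exact ContinuousOn.div (by fun_prop) (by fun_prop) fun t ht =>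
      (pow_pos (cos_pos_of_mem_Icc_zero_pi_div_four ht) 2).ne'

theorem integral_sine_pair (m : ℕ) :
    ∫ t in (0 : ℝ)..(π / 4), t ^ 2 * (2 * sin ((4 * m + 2) * t) - 2 * sin ((4 * m + 4) * t)) =
      π / 4 * ((-1) ^ m / (2 * (m : ℝ) + 1) ^ 2) - 1 / 2 * (1 / (2 * (m : ℝ) + 1) ^ 3)
        - π ^ 2 / 32 * ((-1) ^ m / ((m : ℝ) + 1)) + 1 / 16 * ((-1) ^ m / ((m : ℝ) + 1) ^ 3)
        + 1 / 16 * (1 / ((m : ℝ) + 1) ^ 3) := by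
  have hsplit : ∀ t : ℝ, t ^ 2 * (2 * sin ((4 * m + 2) * t) - 2 * sin ((4 * m + 4) * t)) =
      2 * (t ^ 2 * sin ((4 * m + 2) * t)) - 2 * (t ^ 2 * sin ((4 * m + 4) * t)) := fun t => by ring
  have hm1 : (2 * (m : ℝ) + 1) ≠ 0 := by positivity
  have hm2 : ((m : ℝ) + 1) ≠ 0 := by positivity
  have s1 : sin ((4 * m + 2) * (π / 4)) = (-1) ^ m := by
    rw [show (4 * (m : ℝ) + 2) * (π / 4) = π / 2 + m * π by ring, sin_add_nat_mul_pi]; simp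
  have c1 : cos ((4 * m + 2) * (π / 4)) = 0 := by
    rw [show (4 * (m : ℝ) + 2) * (π / 4) = π / 2 + m * π by ring, cos_add_nat_mul_pi]; simp
  have s2 : sin ((4 * m + 4) * (π / 4)) = 0 := by
    rw [show (4 * (m : ℝ) + 4) * (π / 4) = π + m * π by ring, sin_add_nat_mul_pi]; simp
  have c2 : cos ((4 * m + 4) * (π / 4)) = -(-1) ^ m := by
    rw [show (4 * (m : ℝ) + 4) * (π / 4) = π + m * π by ring, cos_add_nat_mul_pi]; simp
  simp_rw [hsplit]
  rw [intervalIntegral.integral_sub (Continuous.intervalIntegrable (by fun_prop) _ _)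
      (Continuous.intervalIntegrable (by fun_prop) _ _),
    intervalIntegral.integral_const_mul, intervalIntegral.integral_const_mul,
    integral_sq_mul_sin (by positivity), integral_sq_mul_sin (by positivity), s1, c1, s2, c2,
    show (4 * (m : ℝ) + 2) = 2 * (2 * m + 1) by ring, show (4 * (m : ℝ) + 4) = 4 * (m + 1) by ring]
  field_simp
  ring

theorem integral_sq_mul_tan :
    ∫ t in (0 : ℝ)..(π / 4), t ^ 2 * tan t =
      π / 4 * catalanConst - π ^ 2 / 32 * log 2 - 21 / 64 * zeta3 := by
  have hpi : (0 : ℝ) ≤ π / 4 := by positivity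
  have hsum : ∀ N : ℕ, ∑ m ∈ Finset.range N, (∫ t in (0 : ℝ)..(π / 4),
      t ^ 2 * (2 * sin ((4 * m + 2) * t) - 2 * sin ((4 * m + 4) * t))) =
      (∫ t in (0 : ℝ)..(π / 4), t ^ 2 * tan t) -
        ∫ t in (0 : ℝ)..(π / 4), t ^ 2 / cos t * sin ((4 * N + 1) * t) := by
    intro N
    rw [← intervalIntegral.integral_finsetSum
      fun m _ => Continuous.intervalIntegrable (by fun_prop) _ _,
      ← intervalIntegral.integral_sub]
    · refine integral_congr fun t ht => ?_
      rw [Set.uIcc_of_le hpi] at ht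
      rw [← Finset.mul_sum, sum_sin_eq_tan_sub (cos_pos_of_mem_Icc_zero_pi_div_four ht).ne']
      ring
    · exact ContinuousOn.intervalIntegrable_of_Icc hpi continuousOn_sq_mul_tan
    · refine ContinuousOn.intervalIntegrable_of_Icc hpi (ContinuousOn.mul ?_ (by fun_prop))
      exact ContinuousOn.div (by fun_prop) (by fun_prop) fun t ht =>
        (cos_pos_of_mem_Icc_zero_pi_div_four ht).ne'
  have hfreq : Tendsto (fun N : ℕ => 4 * (N : ℝ) + 1) atTop atTop :=
    tendsto_atTop_add_const_right _ _ (tendsto_natCast_atTop_atTop.const_mul_atTop (by norm_num))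
  have hlim := (tendsto_const_nhds (x := ∫ t in (0 : ℝ)..(π / 4), t ^ 2 * tan t)).sub
    (tendsto_integral_sq_div_cos_mul_sin.comp hfreq)
  have hseries := (((((hasSum_catalanConst.tendsto_sum_nat.const_mul (π / 4)).sub
    (hasSum_odd_cubes.tendsto_sum_nat.const_mul (1 / 2))).sub
    (tendsto_alternating_harmonic_log_two.const_mul (π ^ 2 / 32))).add
    (hasSum_alternating_cubes.tendsto_sum_nat.const_mul (1 / 16))).add
    (hasSum_zeta3.tendsto_sum_nat.const_mul (1 / 16)))
  have heq := tendsto_nhds_unique (hlim.congr fun N => (hsum N).symm) (hseries.congr fun N => by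
    simp only [integral_sine_pair, Finset.sum_add_distrib, Finset.sum_sub_distrib,
      Finset.mul_sum])
  linarith

theorem integral_mul_arctan_sq_div :
    ∫ x in (0 : ℝ)..1, x * arctan x ^ 2 / (1 + x ^ 2) =
      ∫ t in (0 : ℝ)..(π / 4), t ^ 2 * tan t := by
  have himage : arctan '' Set.uIcc 0 1 ⊆ Set.Icc 0 (π / 4) := by
    rintro _ ⟨x, hx, rfl⟩
    rw [Set.uIcc_of_le zero_le_one] at hx
    exact ⟨arctan_zero ▸ arctan_strictMono.monotone hx.1,
      arctan_one ▸ arctan_strictMono.monotone hx.2⟩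
  have h := integral_comp_mul_deriv'' (a := 0) (b := 1) (f := arctan)
    (f' := fun x => 1 / (1 + x ^ 2)) (g := fun t => t ^ 2 * tan t)
    continuous_arctan.continuousOn (fun x _ => (hasDerivAt_arctan x).hasDerivWithinAt)
    (Continuous.continuousOn (continuous_const.div (by fun_prop) fun x => by positivity))
    (continuousOn_sq_mul_tan.mono himage)
  rw [arctan_zero, arctan_one] at h
  rw [← h]
  refine integral_congr fun x _ => ?_
  simp only [Function.comp, tan_arctan]
  ring

theorem arctan_cube_integral :
    ∫ x in (0:ℝ)..1, Real.arctan x ^ 3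
      = π ^ 3 / 64 + (3/32) * π ^ 2 * Real.log 2 - (3/4) * π * catalanConst
        + (63/64) * zeta3 := by
  have hderiv : ∀ x ∈ Set.uIcc (0 : ℝ) 1, HasDerivAt (fun x => x * arctan x ^ 3)
      (arctan x ^ 3 + 3 * (x * arctan x ^ 2 / (1 + x ^ 2))) x := by
    intro x _
    refine ((hasDerivAt_id' x).mul ((hasDerivAt_arctan x).pow 3)).congr_deriv ?_
    simp only [Pi.pow_apply]
    push_cast
    ring
  have hcont : Continuous fun x : ℝ => x * arctan x ^ 2 / (1 + x ^ 2) :=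
    Continuous.div (by fun_prop) (by fun_prop) fun x => by positivity
  have hcube : Continuous fun x : ℝ => arctan x ^ 3 := by fun_prop
  have h := integral_eq_sub_of_hasDerivAt hderiv
    ((hcube.add (hcont.const_mul 3)).intervalIntegrable _ _)
  rw [intervalIntegral.integral_add (hcube.intervalIntegrable _ _)
    ((hcont.const_mul 3).intervalIntegrable _ _), intervalIntegral.integral_const_mul,
    integral_mul_arctan_sq_div, integral_sq_mul_tan, arctan_one] at h
  linarith
end

section
/- For every integer p ≥ 1, ∫₀^{π/2} x^p·cot(x) dx = (π/2)^p·( log 2 + ∑_{k=1}^{⌊p/2⌋} p!·(−1)^k·(4^k−1)/((p−2k)!·(2π)^{2k})·ζ(2k+1) ) + [p even]·p!·(−1)^{p/2}/2^p·ζ(p+1). -/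
open Real

/-- `ζ(s) = ∑_{n≥1} 1/n^s` (natural exponent). -/
noncomputable def zetaVal (s : ℕ) : ℝ := ∑' n : ℕ, 1 / ((n : ℝ) + 1) ^ s

open Filter Topology MeasureTheory

open scoped FourierTransform

/-- The **Riemann–Lebesgue lemma** for the cosine transform on a bounded interval. -/
lemma tendsto_integral_mul_cos_atTop {a b : ℝ} (hab : a ≤ b) {g : ℝ → ℝ}
    (hg : IntervalIntegrable g volume a b) :
    Tendsto (fun t : ℝ => ∫ x in a..b, g x * Real.cos (t * x)) atTop (𝓝 0) := by
  set f : ℝ → ℂ := (Set.Ioc a b).indicator fun x => (g x : ℂ) with hf_def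
  have hf : Integrable f := by
    rw [hf_def, integrable_indicator_iff measurableSet_Ioc]
    exact ((intervalIntegrable_iff_integrableOn_Ioc_of_le hab).1 hg).ofReal
  have h1 : Tendsto (fun t : ℝ => t / (2 * π)) atTop (cocompact ℝ) :=
    (tendsto_id.atTop_div_const (by positivity)).mono_right atTop_le_cocompact
  have h2 := (Complex.continuous_re.tendsto _).comp
    ((Real.tendsto_integral_exp_smul_cocompact f).comp h1)
  rw [Complex.zero_re] at h2
  refine h2.congr fun t => ?_
  have hint : Integrable fun v : ℝ => 𝐞 (-(v * (t / (2 * π)))) • f v := by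
    refine hf.norm.mono' ?_ (Eventually.of_forall fun v => by simp)
    refine AEStronglyMeasurable.smul ?_ hf.aestronglyMeasurable
    exact (by fun_prop : Continuous fun v : ℝ =>
      ((𝐞 (-(v * (t / (2 * π)))) : Circle) : ℂ)).aestronglyMeasurable
  have h3 := Complex.reCLM.integral_comp_comm hint
  simp only [Complex.reCLM_apply] at h3
  simp only [Function.comp_apply]
  rw [← h3, intervalIntegral.integral_of_le hab, ← integral_indicator measurableSet_Ioc]
  refine integral_congr_ae (Eventually.of_forall fun v => ?_)
  by_cases hv : v ∈ Set.Ioc a b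
  · simp only [hf_def, Set.indicator_of_mem hv, Circle.smul_def, Real.fourierChar_apply,
      smul_eq_mul, Complex.re_mul_ofReal, Complex.exp_ofReal_mul_I_re]
    rw [show 2 * π * -(v * (t / (2 * π))) = -(t * v) by field_simp, Real.cos_neg, mul_comm]
  · simp [hf_def, Set.indicator_of_notMem hv]

lemma cos_eq_two_mul_sum_sin_mul_sin_add_cos (x : ℝ) (N : ℕ) :
    Real.cos x = 2 * (∑ n ∈ Finset.range N, Real.sin (2 * ((n : ℝ) + 1) * x)) * Real.sin x
      + Real.cos ((2 * N + 1) * x) := by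
  induction N with
  | zero => simp
  | succ N ih =>
    rw [Finset.sum_range_succ]
    have h1 : Real.cos ((2 * N + 1) * x) = Real.cos (2 * ((N : ℝ) + 1) * x - x) := by
      ring_nf
    have h2 : Real.cos ((2 * (N + 1 : ℕ) + 1) * x) = Real.cos (2 * ((N : ℝ) + 1) * x + x) := by
      push_cast; ring_nf
    rw [h1, Real.cos_sub] at ih
    rw [h2, Real.cos_add]
    linear_combination ih

lemma intervalIntegrable_pow_div_sin {p : ℕ} (hp : 1 ≤ p) :
    IntervalIntegrable (fun x : ℝ => x ^ p / Real.sin x) volume 0 (π / 2) := by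
  rw [intervalIntegrable_iff_integrableOn_Ioc_of_le (by positivity)]
  refine Measure.integrableOn_of_bounded (M := (π / 2) ^ p) (by simp) ?_ ?_
  · exact ((measurable_id.pow_const p).div Real.measurable_sin).aestronglyMeasurable
  · refine (ae_restrict_iff' measurableSet_Ioc).2 (Eventually.of_forall fun x hx => ?_)
    have hx0 : 0 < x := hx.1
    have hs : 2 / π * x ≤ Real.sin x := Real.mul_le_sin hx.1.le hx.2
    have hs0 : 0 < Real.sin x := lt_of_lt_of_le (by positivity) hs
    rw [Real.norm_of_nonneg (by positivity), div_le_iff₀ hs0]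
    obtain ⟨q, rfl⟩ : ∃ q, p = q + 1 := ⟨p - 1, by omega⟩
    calc x ^ (q + 1) ≤ (π / 2) ^ q * x := by
          rw [pow_succ]; gcongr; exact hx.2
      _ = (π / 2) ^ (q + 1) * (2 / π * x) := by rw [pow_succ]; field_simp
      _ ≤ _ := by gcongr

lemma tendsto_sum_integral_pow_mul_sin {p : ℕ} (hp : 1 ≤ p) :
    Tendsto (fun N : ℕ => ∑ n ∈ Finset.range N,
        2 * ∫ x in (0:ℝ)..(π / 2), x ^ p * Real.sin (2 * ((n : ℝ) + 1) * x)) atTop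
      (𝓝 (∫ x in (0:ℝ)..(π / 2), x ^ p * (Real.cos x / Real.sin x))) := by
  have hpi : (0:ℝ) ≤ π / 2 := by positivity
  have hg := intervalIntegrable_pow_div_sin hp
  have hN : Tendsto (fun N : ℕ => (2 * (N : ℝ) + 1)) atTop atTop :=
    tendsto_atTop_add_const_right _ _ (tendsto_natCast_atTop_atTop.const_mul_atTop two_pos)
  have h := (tendsto_integral_mul_cos_atTop hpi hg).comp hN
  have h' := (tendsto_const_nhds
    (x := ∫ x in (0:ℝ)..(π / 2), x ^ p * (Real.cos x / Real.sin x))).sub h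
  rw [sub_zero] at h'
  refine h'.congr fun N => ?_
  have hsin : ∀ n : ℕ, IntervalIntegrable
      (fun x : ℝ => 2 * (x ^ p * Real.sin (2 * ((n : ℝ) + 1) * x))) volume 0 (π / 2) :=
    fun n => (by fun_prop : Continuous _).intervalIntegrable _ _
  have hsum : IntervalIntegrable (fun x : ℝ => ∑ n ∈ Finset.range N,
      2 * (x ^ p * Real.sin (2 * ((n : ℝ) + 1) * x))) volume 0 (π / 2) :=
    (by fun_prop : Continuous _).intervalIntegrable _ _
  have hcos : IntervalIntegrable (fun x : ℝ => x ^ p / Real.sin x *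
      Real.cos ((2 * N + 1) * x)) volume 0 (π / 2) :=
    hg.mul_continuousOn (by fun_prop : Continuous _).continuousOn
  have key : ∫ x in (0:ℝ)..(π / 2), x ^ p * (Real.cos x / Real.sin x) =
      ∫ x in (0:ℝ)..(π / 2), ((∑ n ∈ Finset.range N,
        2 * (x ^ p * Real.sin (2 * ((n : ℝ) + 1) * x))) +
        x ^ p / Real.sin x * Real.cos ((2 * N + 1) * x)) := by
    refine intervalIntegral.integral_congr fun x hx => ?_
    rw [Set.uIcc_of_le hpi] at hx
    rcases hx.1.eq_or_lt with rfl | hx0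
    · simp [show p ≠ 0 by omega]
    · have hs0 : Real.sin x ≠ 0 :=
        (Real.sin_pos_of_pos_of_lt_pi hx0 (by linarith [hx.2, Real.pi_pos])).ne'
      simp only [← Finset.mul_sum]
      have := cos_eq_two_mul_sum_sin_mul_sin_add_cos x N
      rw [← mul_div_assoc, div_mul_eq_mul_div, div_eq_iff hs0, add_mul, div_mul_cancel₀ _ hs0]
      linear_combination x ^ p * this
  rw [key, intervalIntegral.integral_add hsum hcos,
    intervalIntegral.integral_finsetSum fun n _ => hsin n]
  simp [intervalIntegral.integral_const_mul]

lemma integral_pow_succ_mul_sin {c : ℝ} (hc : c ≠ 0) (p : ℕ) (b : ℝ) :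
    ∫ x in (0:ℝ)..b, x ^ (p + 1) * Real.sin (c * x) =
      -(b ^ (p + 1) * Real.cos (c * b) / c)
        + (p + 1) / c * ∫ x in (0:ℝ)..b, x ^ p * Real.cos (c * x) := by
  have h := intervalIntegral.integral_mul_deriv_eq_deriv_mul (a := 0) (b := b)
    (u := fun x : ℝ => x ^ (p + 1)) (u' := fun x => ((p + 1 : ℕ) : ℝ) * x ^ p)
    (v := fun x => -(Real.cos (c * x) / c)) (v' := fun x => Real.sin (c * x))
    (fun x _ => by simpa using hasDerivAt_pow (p + 1) x)
    (fun x _ => by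
      have := ((((hasDerivAt_id x).const_mul c).cos).div_const c).neg
      refine this.congr_deriv ?_
      simp only [id]
      field_simp)
    ((by fun_prop : Continuous _).intervalIntegrable _ _)
    ((by fun_prop : Continuous _).intervalIntegrable _ _)
  rw [h, ← intervalIntegral.integral_const_mul, ← sub_neg_eq_add _ (∫ x in (0:ℝ)..b, _),
    ← intervalIntegral.integral_neg]
  congr 1
  · simp; ring
  · congr 1; ext x; push_cast; ring

lemma integral_pow_succ_mul_cos {c : ℝ} (hc : c ≠ 0) (p : ℕ) (b : ℝ) :
    ∫ x in (0:ℝ)..b, x ^ (p + 1) * Real.cos (c * x) =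
      b ^ (p + 1) * Real.sin (c * b) / c
        - (p + 1) / c * ∫ x in (0:ℝ)..b, x ^ p * Real.sin (c * x) := by
  have h := intervalIntegral.integral_mul_deriv_eq_deriv_mul (a := 0) (b := b)
    (u := fun x : ℝ => x ^ (p + 1)) (u' := fun x => ((p + 1 : ℕ) : ℝ) * x ^ p)
    (v := fun x => Real.sin (c * x) / c) (v' := fun x => Real.cos (c * x))
    (fun x _ => by simpa using hasDerivAt_pow (p + 1) x)
    (fun x _ => by
      have := (((hasDerivAt_id x).const_mul c).sin).div_const c
      refine this.congr_deriv ?_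
      simp only [id]
      field_simp)
    ((by fun_prop : Continuous _).intervalIntegrable _ _)
    ((by fun_prop : Continuous _).intervalIntegrable _ _)
  rw [h, ← intervalIntegral.integral_const_mul]
  congr 1
  · simp; ring
  · congr 1; ext x; push_cast; ring

lemma integral_pow_mul_sin_two_mul (n : ℕ) (p : ℕ) :
    ∫ x in (0:ℝ)..(π / 2), x ^ p * Real.sin (2 * ((n : ℝ) + 1) * x) =
      (-1) ^ n * ∑ k ∈ Finset.range (p / 2 + 1), (-1) ^ k * (p.factorial : ℝ) /
          (p - 2 * k).factorial * (π / 2) ^ (p - 2 * k) / (2 * ((n : ℝ) + 1)) ^ (2 * k + 1)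
        + if Even p then (-1) ^ (p / 2) * (p.factorial : ℝ) / (2 * ((n : ℝ) + 1)) ^ (p + 1)
          else 0 := by
  have hc : 2 * ((n : ℝ) + 1) ≠ 0 := by positivity
  have harg : 2 * ((n : ℝ) + 1) * (π / 2) = ((n + 1 : ℕ) : ℝ) * π := by push_cast; ring
  have hcosb : Real.cos (2 * ((n : ℝ) + 1) * (π / 2)) = -(-1) ^ n := by
    rw [harg, Real.cos_nat_mul_pi, pow_succ]; ring
  have hsinb : Real.sin (2 * ((n : ℝ) + 1) * (π / 2)) = 0 := by
    rw [harg, Real.sin_nat_mul_pi]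
  induction p using Nat.twoStepInduction with
  | zero =>
    have h := intervalIntegral.integral_comp_mul_left (a := 0) (b := π / 2) Real.sin hc
    simp only [pow_zero, one_mul, h, integral_sin, hcosb]
    simp
    field_simp
    ring
  | one =>
    have h := intervalIntegral.integral_comp_mul_left (a := 0) (b := π / 2) Real.cos hc
    rw [integral_pow_succ_mul_sin hc 0]
    simp only [pow_zero, one_mul, h, integral_cos, hcosb, hsinb]
    simp
    ring
  | more p ih _ =>
    rw [integral_pow_succ_mul_sin hc (p + 1), integral_pow_succ_mul_cos hc p, ih, hcosb, hsinb,
      show (p + 2) / 2 = p / 2 + 1 by omega, Finset.sum_range_succ' _ (p / 2 + 1)]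
    have hterm : ∀ k : ℕ, (-1 : ℝ) ^ (k + 1) * ((p + 2).factorial : ℝ) /
        (p + 2 - 2 * (k + 1)).factorial * (π / 2) ^ (p + 2 - 2 * (k + 1)) /
          (2 * ((n : ℝ) + 1)) ^ (2 * (k + 1) + 1) =
        -((p + 2) * (p + 1) / (2 * ((n : ℝ) + 1)) ^ 2) * ((-1) ^ k * (p.factorial : ℝ) /
          (p - 2 * k).factorial * (π / 2) ^ (p - 2 * k) / (2 * ((n : ℝ) + 1)) ^ (2 * k + 1)) := by
      intro k
      rw [show p + 2 - 2 * (k + 1) = p - 2 * k by omega, Nat.factorial_succ, Nat.factorial_succ]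
      have : ((p - 2 * k).factorial : ℝ) ≠ 0 := by positivity
      push_cast
      field_simp
      ring
    simp only [hterm, ← Finset.mul_sum]
    have hfac : ((p + 2).factorial : ℝ) ≠ 0 := by positivity
    have heven : (if Even (p + 2) then (-1 : ℝ) ^ (p / 2 + 1) * ((p + 2).factorial : ℝ) /
          (2 * ((n : ℝ) + 1)) ^ (p + 2 + 1) else 0) =
        -((p + 2) * (p + 1) / (2 * ((n : ℝ) + 1)) ^ 2) * (if Even p then (-1) ^ (p / 2) *
          (p.factorial : ℝ) / (2 * ((n : ℝ) + 1)) ^ (p + 1) else 0) := by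
      have : Even (p + 2) ↔ Even p := by simp [Nat.even_add]
      simp only [this]
      split_ifs
      · rw [Nat.factorial_succ, Nat.factorial_succ]
        push_cast
        field_simp
        ring
      · simp
    rw [heven]
    simp only [mul_zero, Nat.sub_zero, pow_zero, one_mul, zero_add, pow_one, div_self hfac]
    generalize (∑ k ∈ Finset.range (p / 2 + 1), _ : ℝ) = S
    generalize (if Even p then _ else _ : ℝ) = E
    push_cast
    field_simp
    ring

/-- The alternating harmonic series sums to `log 2`. -/
lemma tendsto_sum_alternating_harmonic :
    Tendsto (fun N : ℕ => ∑ n ∈ Finset.range N, (-1 : ℝ) ^ n / ((n : ℝ) + 1)) atTop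
      (𝓝 (Real.log 2)) := by
  obtain ⟨l, h⟩ : ∃ l, Tendsto (fun N : ℕ => ∑ n ∈ Finset.range N, (-1 : ℝ) ^ n / ((n : ℝ) + 1))
      atTop (𝓝 l) := by
    simp only [div_eq_mul_one_div ((-1 : ℝ) ^ _)]
    refine Antitone.tendsto_alternating_series_of_tendsto_zero ?_
      tendsto_one_div_add_atTop_nhds_zero_nat
    intro a b hab
    dsimp only
    gcongr
  have hle : 𝓝[<] (1 : ℝ) ≤ 𝓝 1 := nhdsWithin_le_nhds
  have abel := (Real.tendsto_tsum_powerSeries_nhdsWithin_lt h).mul (tendsto_id.mono_right hle)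
  rw [mul_one] at abel
  have hlog : Tendsto (fun x : ℝ => Real.log (1 + x)) (𝓝[<] 1) (𝓝 (Real.log 2)) := by
    have : ContinuousAt (fun x : ℝ => Real.log (1 + x)) 1 :=
      ContinuousAt.log (by fun_prop) (by norm_num)
    have h2 := this.tendsto.mono_left hle
    norm_num at h2
    exact h2
  have heq : (fun x : ℝ => (∑' n : ℕ, (-1 : ℝ) ^ n / ((n : ℝ) + 1) * x ^ n) * id x) =ᶠ[𝓝[<] 1]
      fun x => Real.log (1 + x) := by
    filter_upwards [Ioo_mem_nhdsLT (show (-1 : ℝ) < 1 by norm_num)] with x hx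
    have hs := (Real.hasSum_pow_div_log_of_abs_lt_one (x := -x)
      (by rw [abs_neg, abs_lt]; exact hx)).neg
    rw [neg_neg, sub_neg_eq_add] at hs
    rw [← hs.tsum_eq, ← tsum_mul_right]
    refine tsum_congr fun n => ?_
    rw [neg_pow x, id]
    ring
  rwa [← tendsto_nhds_unique (abel.congr' heq) hlog]

lemma hasSum_zetaVal {s : ℕ} (hs : 2 ≤ s) :
    HasSum (fun n : ℕ => 1 / ((n : ℝ) + 1) ^ s) (zetaVal s) := by
  have h := (summable_nat_add_iff 1).2 (Real.summable_one_div_nat_pow.2 (by omega : 1 < s))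
  push_cast at h
  exact h.hasSum

/-- The Dirichlet eta function at integers in terms of the zeta function. -/
lemma hasSum_alternating_zetaVal {s : ℕ} (hs : 2 ≤ s) :
    HasSum (fun n : ℕ => (-1 : ℝ) ^ n / ((n : ℝ) + 1) ^ s) ((1 - 2 / 2 ^ s) * zetaVal s) := by
  have hz := hasSum_zetaVal hs
  have hodd : HasSum (fun k : ℕ => 1 / (((2 * k + 1 : ℕ) : ℝ) + 1) ^ s)
      (1 / 2 ^ s * zetaVal s) := by
    have hk : (fun k : ℕ => 1 / (((2 * k + 1 : ℕ) : ℝ) + 1) ^ s) =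
        fun k : ℕ => 1 / 2 ^ s * (1 / ((k : ℝ) + 1) ^ s) := by
      ext k
      push_cast
      rw [show (2 * (k : ℝ) + 1 + 1) = 2 * (k + 1) by ring, mul_pow]
      field_simp
    rw [hk]
    exact hz.mul_left _
  have hev : Summable (fun k : ℕ => 1 / (((2 * k : ℕ) : ℝ) + 1) ^ s) :=
    hz.summable.comp_injective (mul_right_injective₀ (two_ne_zero' ℕ))
  have htot := hev.hasSum.even_add_odd (f := fun n : ℕ => 1 / ((n : ℝ) + 1) ^ s) hodd
  have hval := htot.unique hz
  have := HasSum.even_add_odd (f := fun n : ℕ => (-1 : ℝ) ^ n / ((n : ℝ) + 1) ^ s)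
    (by simpa [pow_mul] using hev.hasSum)
    (by simpa [pow_mul, pow_succ, neg_div] using hodd.neg)
  convert this using 1
  simp at hval ⊢
  linear_combination -hval

theorem integral_pow_mul_cot (p : ℕ) (hp : 1 ≤ p) :
    ∫ x in (0:ℝ)..(π/2), x ^ p * (Real.cos x / Real.sin x)
      = (π/2) ^ p * (Real.log 2 +
          ∑ k ∈ Finset.Icc 1 (p/2),
            (Nat.factorial p : ℝ) * (-1) ^ k * (4 ^ k - 1) /
              ((Nat.factorial (p - 2*k) : ℝ) * (2*π) ^ (2*k)) * zetaVal (2*k+1))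
        + (if Even p then (Nat.factorial p : ℝ) * (-1) ^ (p/2) / 2 ^ p * zetaVal (p+1)
           else 0) := by
  have hlog := tendsto_sum_alternating_harmonic.const_mul ((π / 2) ^ p)
  have heta : ∀ k ∈ Finset.Icc 1 (p / 2), Tendsto (fun N : ℕ => ∑ n ∈ Finset.range N,
      2 * ((-1 : ℝ) ^ k * p.factorial / (p - 2 * k).factorial * (π / 2) ^ (p - 2 * k) /
        2 ^ (2 * k + 1)) * ((-1 : ℝ) ^ n / ((n : ℝ) + 1) ^ (2 * k + 1))) atTop
      (𝓝 ((π / 2) ^ p * ((Nat.factorial p : ℝ) * (-1) ^ k * (4 ^ k - 1) /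
              ((Nat.factorial (p - 2*k) : ℝ) * (2*π) ^ (2*k)) * zetaVal (2*k+1)))) := by
    intro k hk
    rw [Finset.mem_Icc] at hk
    have h := ((hasSum_alternating_zetaVal (s := 2 * k + 1) (by omega)).mul_left
      (2 * ((-1 : ℝ) ^ k * p.factorial / (p - 2 * k).factorial * (π / 2) ^ (p - 2 * k) /
        2 ^ (2 * k + 1)))).tendsto_sum_nat
    convert h using 2
    obtain ⟨q, rfl⟩ : ∃ q, p = q + 2 * k := ⟨p - 2 * k, by omega⟩
    have : (q.factorial : ℝ) ≠ 0 := by positivity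
    rw [Nat.add_sub_cancel, show (4 : ℝ) = 2 ^ 2 by norm_num, ← pow_mul]
    simp only [pow_add, div_pow, mul_pow, pow_one]
    field_simp
  have hzeta : Tendsto (fun N : ℕ => ∑ n ∈ Finset.range N, 2 *
      (if Even p then (-1 : ℝ) ^ (p / 2) * p.factorial / (2 * ((n : ℝ) + 1)) ^ (p + 1) else 0))
      atTop (𝓝 (if Even p then (Nat.factorial p : ℝ) * (-1) ^ (p/2) / 2 ^ p * zetaVal (p+1)
        else 0)) := by
    split_ifs
    · convert ((hasSum_zetaVal (s := p + 1) (by omega)).mul_left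
        ((Nat.factorial p : ℝ) * (-1) ^ (p/2) / 2 ^ p)).tendsto_sum_nat using 3 with N n
      rw [mul_pow, pow_succ 2]
      field_simp
    · simp
  refine tendsto_nhds_unique (tendsto_sum_integral_pow_mul_sin hp) ?_
  rw [mul_add, Finset.mul_sum]
  refine ((hlog.add (tendsto_finsetSum _ heta)).add hzeta).congr fun N => ?_
  rw [Finset.mul_sum, Finset.sum_comm, ← Finset.sum_add_distrib, ← Finset.sum_add_distrib]
  refine Finset.sum_congr rfl fun n _ => ?_
  rw [integral_pow_mul_sin_two_mul, Finset.range_eq_Ico,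
    Finset.sum_eq_sum_Ico_succ_bot (by omega), mul_add ((-1) ^ n), mul_add 2 (_ * _ + _) _,
    mul_add 2 (_ * _) _, Finset.mul_sum, Finset.mul_sum]
  congr 2
  · have : (p.factorial : ℝ) ≠ 0 := by positivity
    simp [this]
    field_simp
  · refine Finset.sum_congr rfl fun k _ => ?_
    rw [mul_pow]
    field_simp
end

section
/- For every integer r ≥ 1, ∫₀¹ arctan(x)^r/x dx = r!·∑_{n₁>n₂>⋯>n_r>0} (−1)^{n₁−r} / ((2n₁−r)²·(2n₂−r+1)⋯(2n_r−1)). -/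
open Real Filter Classical

/-- The nested sum `∑_{N ≥ n₁ > ⋯ > n_r > 0} ∏_j 1/(2n_j - r + j - 1)`, defined recursively by
splitting off the largest index. -/
noncomputable def nestedSum : ℕ → ℕ → ℝ
  | 0, _ => 1
  | r + 1, N => ∑ n ∈ Finset.range N, nestedSum r n / (2 * n + 1 - r)

/-- Truncations of the power series of `arctan x ^ r / r!`. -/
noncomputable def arctanPowPartialSum : ℕ → ℕ → ℝ → ℝ
  | 0, _, _ => 1
  | r + 1, N, x => ∑ n ∈ Finset.range N,
      (-1) ^ (n + r) * (nestedSum r n / (2 * n + 1 - r)) * x ^ (2 * n + 1 - r)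

lemma nestedSum_eq_zero_of_lt {r n : ℕ} (h : n < r) : nestedSum r n = 0 := by
  induction r generalizing n with
  | zero => omega
  | succ r ih =>
    rw [nestedSum]
    refine Finset.sum_eq_zero fun k hk => ?_
    rw [ih (by have := Finset.mem_range.mp hk; omega), zero_div]

lemma nestedSum_nonneg (r n : ℕ) : 0 ≤ nestedSum r n := by
  induction r generalizing n with
  | zero => simp [nestedSum]
  | succ r ih =>
    rw [nestedSum]
    refine Finset.sum_nonneg fun k _ => ?_
    rcases lt_or_ge k r with h | h
    · simp [nestedSum_eq_zero_of_lt h]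
    · have : (r : ℝ) ≤ k := by exact_mod_cast h
      exact div_nonneg (ih k) (by have := Nat.cast_nonneg (α := ℝ) k; linarith)

lemma tendsto_nestedSum_div (r : ℕ) :
    Tendsto (fun N : ℕ => nestedSum r N / (2 * N + 1 - r)) atTop (nhds 0) := by
  have key : ∀ s : ℕ, Tendsto (fun N : ℕ => nestedSum s N / N) atTop (nhds 0) →
      Tendsto (fun N : ℕ => nestedSum s N / (2 * N + 1 - s)) atTop (nhds 0) := by
    intro s hs
    refine squeeze_zero' ?_ ?_ hs
    · filter_upwards [eventually_ge_atTop s] with N hN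
      have : (s : ℝ) ≤ N := by exact_mod_cast hN
      exact div_nonneg (nestedSum_nonneg s N)
        (by have := Nat.cast_nonneg (α := ℝ) N; linarith)
    · filter_upwards [eventually_ge_atTop s, eventually_gt_atTop 0] with N hN hN0
      have : (s : ℝ) ≤ N := by exact_mod_cast hN
      have : (0 : ℝ) < N := by exact_mod_cast hN0
      exact div_le_div_of_nonneg_left (nestedSum_nonneg s N) this (by linarith)
  refine key r ?_
  induction r with
  | zero => simpa [nestedSum] using tendsto_inv_atTop_nhds_zero_nat (𝕜 := ℝ)
  | succ r ih =>
    refine (key r ih).cesaro.congr fun N => ?_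
    rw [nestedSum]
    ring

lemma one_add_sq_mul_geometric_nestedSum (r N : ℕ) (x : ℝ) :
    (1 + x ^ 2) * ∑ n ∈ Finset.range N, (-1) ^ (n + r) * nestedSum r n * x ^ (2 * n - r) =
      arctanPowPartialSum r N x - (-1) ^ (N + r) * nestedSum r N * x ^ (2 * N - r) := by
  induction N with
  | zero =>
    cases r with
    | zero => simp [arctanPowPartialSum, nestedSum]
    | succ r => simp [arctanPowPartialSum, nestedSum]
  | succ N ih =>
    rw [Finset.sum_range_succ, mul_add, ih]
    cases r with
    | zero =>
      simp only [arctanPowPartialSum, nestedSum, Nat.sub_zero, mul_add, pow_add, mul_one]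
      ring
    | succ s =>
      have hs : nestedSum (s + 1) (N + 1) =
          nestedSum (s + 1) N + nestedSum s N / (2 * N + 1 - s) := by
        simp only [nestedSum, Finset.sum_range_succ]
      have hx : nestedSum (s + 1) N * x ^ (2 * (N + 1) - (s + 1)) =
          nestedSum (s + 1) N * x ^ (2 * N - (s + 1)) * x ^ 2 := by
        rcases lt_or_ge N (s + 1) with h | h
        · simp [nestedSum_eq_zero_of_lt h]
        · rw [mul_assoc, ← pow_add]
          congr 2
          omega
      have he : 2 * (N + 1) - (s + 1) = 2 * N + 1 - s := by omega
      have hsign : ((-1 : ℝ)) ^ (N + 1 + (s + 1)) = - (-1) ^ (N + (s + 1)) := by ring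
      have hsign' : ((-1 : ℝ)) ^ (N + s) = - (-1) ^ (N + (s + 1)) := by ring
      rw [hs, hsign]
      simp only [arctanPowPartialSum, Finset.sum_range_succ]
      rw [hsign', he]
      rw [he] at hx
      linear_combination (-1) * (-1) ^ (N + (s + 1)) * hx

lemma hasDerivAt_arctanPowPartialSum_succ (r N : ℕ) (x : ℝ) :
    HasDerivAt (arctanPowPartialSum (r + 1) N)
      ((arctanPowPartialSum r N x - (-1) ^ (N + r) * nestedSum r N * x ^ (2 * N - r)) /
        (1 + x ^ 2)) x := by
  have hpos : (1 + x ^ 2 : ℝ) ≠ 0 := by positivity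
  rw [← one_add_sq_mul_geometric_nestedSum, mul_div_cancel_left₀ _ hpos]
  have : arctanPowPartialSum (r + 1) N = fun x => ∑ n ∈ Finset.range N,
      (-1) ^ (n + r) * (nestedSum r n / (2 * n + 1 - r)) * x ^ (2 * n + 1 - r) := by
    ext x
    rw [arctanPowPartialSum]
  rw [this]
  refine HasDerivAt.fun_sum fun n _ => ?_
  rcases lt_or_ge n r with h | h
  · simpa [nestedSum_eq_zero_of_lt h] using hasDerivAt_const x (0 : ℝ)
  · have h' : (r : ℝ) ≤ n := by exact_mod_cast h
    have hn : (2 * n + 1 - r : ℝ) ≠ 0 := by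
      have := Nat.cast_nonneg (α := ℝ) n
      linarith
    refine ((hasDerivAt_pow (2 * n + 1 - r) x).const_mul
      ((-1) ^ (n + r) * (nestedSum r n / (2 * n + 1 - r)))).congr_deriv ?_
    rw [Nat.cast_sub (by omega), show 2 * n + 1 - r - 1 = 2 * n - r by omega]
    push_cast
    field_simp

lemma exists_tendsto_zero_abs_arctanPowPartialSum_sub_le (r : ℕ) :
    ∃ ε : ℕ → ℝ, Tendsto ε atTop (nhds 0) ∧ ∀ᶠ N in atTop, ∀ x ∈ Set.Icc (0 : ℝ) 1,
      |arctanPowPartialSum r N x - arctan x ^ r / r.factorial| ≤ ε N * x := by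
  induction r with
  | zero => exact ⟨fun _ => 0, tendsto_const_nhds, by simp [arctanPowPartialSum]⟩
  | succ r ih =>
    obtain ⟨ε, hε, hb⟩ := ih
    refine ⟨fun N => ε N + nestedSum r N / (2 * N + 1 - r),
      by simpa using hε.add (tendsto_nestedSum_div r), ?_⟩
    filter_upwards [hb, eventually_ge_atTop r] with N hN hrN x hx
    have hrN' : (r : ℝ) ≤ N := by exact_mod_cast hrN
    have hden : (0 : ℝ) < 2 * N + 1 - r := by
      have := Nat.cast_nonneg (α := ℝ) N
      linarith
    have hε0 : 0 ≤ ε N := by simpa using (abs_nonneg _).trans (hN 1 (by simp))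
    have hfac : (r.factorial : ℝ) ≠ 0 := by positivity
    have hderiv : ∀ y : ℝ, HasDerivAt
        (fun x => arctanPowPartialSum (r + 1) N x - arctan x ^ (r + 1) / (r + 1).factorial)
        ((arctanPowPartialSum r N y - (-1) ^ (N + r) * nestedSum r N * y ^ (2 * N - r)) /
          (1 + y ^ 2) - arctan y ^ r / r.factorial / (1 + y ^ 2)) y := by
      intro y
      refine (hasDerivAt_arctanPowPartialSum_succ r N y).sub ?_
      refine (((hasDerivAt_arctan y).pow (r + 1)).div_const
        ((r + 1).factorial : ℝ)).congr_deriv ?_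
      rw [Nat.factorial_succ]
      push_cast
      field_simp
    have hbound : ∀ y : ℝ, HasDerivAt
        (fun x => ε N * x + nestedSum r N / (2 * N + 1 - r) * x ^ (2 * N + 1 - r))
        (ε N + nestedSum r N * y ^ (2 * N - r)) y := by
      intro y
      refine (((hasDerivAt_id y).const_mul (ε N)).add ((hasDerivAt_pow (2 * N + 1 - r) y).const_mul
        (nestedSum r N / (2 * N + 1 - r)))).congr_deriv ?_
      rw [Nat.cast_sub (by omega), show 2 * N + 1 - r - 1 = 2 * N - r by omega]
      push_cast
      field_simp
    have hle := image_norm_le_of_norm_deriv_right_le_deriv_boundary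
      (fun y _ => (hderiv y).continuousAt.continuousWithinAt)
      (fun y _ => (hderiv y).hasDerivWithinAt) (a := 0) (b := 1)
      (by
        have h0 : 2 * N + 1 - r ≠ 0 := by omega
        have hP : arctanPowPartialSum (r + 1) N 0 = 0 := by
          rw [arctanPowPartialSum]
          refine Finset.sum_eq_zero fun n _ => ?_
          rcases lt_or_ge n r with h | h
          · simp [nestedSum_eq_zero_of_lt h]
          · rw [zero_pow (by omega), mul_zero]
        simp [hP, h0])
      hbound
      (by
        intro y hy
        have hy' : y ∈ Set.Icc (0 : ℝ) 1 := ⟨hy.1, hy.2.le⟩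
        rw [← sub_div, Real.norm_eq_abs, abs_div, abs_of_pos (by positivity : (0 : ℝ) < 1 + y ^ 2)]
        have hD : 0 ≤ nestedSum r N * y ^ (2 * N - r) :=
          mul_nonneg (nestedSum_nonneg r N) (pow_nonneg hy.1 _)
        refine (div_le_self (abs_nonneg _) (by nlinarith [sq_nonneg y])).trans ?_
        rw [sub_right_comm]
        refine (abs_sub _ _).trans (add_le_add ((hN y hy').trans ?_) ?_)
        · exact mul_le_of_le_one_right hε0 hy'.2
        · rw [mul_assoc, abs_mul, abs_pow, abs_neg, abs_one, one_pow, one_mul, abs_of_nonneg hD])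
      hx
    refine hle.trans ?_
    rw [add_mul]
    refine add_le_add le_rfl (mul_le_mul_of_nonneg_left ?_
      (div_nonneg (nestedSum_nonneg r N) hden.le))
    exact pow_le_of_le_one hx.1 hx.2 (by omega)

lemma intervalIntegrable_arctan_pow_succ_div (r : ℕ) (a b : ℝ) :
    IntervalIntegrable (fun x => arctan x ^ (r + 1) / x) MeasureTheory.volume a b := by
  have hc : Continuous (fun x => arctan x ^ r * dslope arctan 0 x) := by
    refine (continuous_arctan.pow r).mul (continuous_iff_continuousAt.2 fun x => ?_)
    rcases eq_or_ne x 0 with rfl | hx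
    · exact continuousAt_dslope_same.2 (differentiableAt_arctan 0)
    · exact (continuousAt_dslope_of_ne hx).2 continuous_arctan.continuousAt
  refine (hc.intervalIntegrable a b).congr_ae ?_
  refine MeasureTheory.ae_restrict_of_ae ?_
  filter_upwards [MeasureTheory.Measure.ae_ne MeasureTheory.volume (0 : ℝ)] with x hx
  rw [dslope_of_ne _ hx, slope_def_field, arctan_zero]
  simp only [sub_zero, pow_succ]
  ring

lemma integral_arctanPowPartialSum_succ_div (r N : ℕ) :
    IntervalIntegrable (fun x => arctanPowPartialSum (r + 1) N x / x) MeasureTheory.volume 0 1 ∧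
    ∫ x in (0 : ℝ)..1, arctanPowPartialSum (r + 1) N x / x =
      ∑ n ∈ Finset.range N, (-1) ^ (n + r) / (2 * n + 1 - r) *
        (nestedSum r n / (2 * n + 1 - r) : ℝ) := by
  have heq : Set.EqOn (fun x : ℝ => ∑ n ∈ Finset.range N,
        (-1) ^ (n + r) * (nestedSum r n / (2 * n + 1 - r)) * x ^ (2 * n - r))
      (fun x => arctanPowPartialSum (r + 1) N x / x) (Set.uIoc 0 1) := by
    intro x hx
    rw [Set.uIoc_of_le zero_le_one] at hx
    have hx0 : x ≠ 0 := hx.1.ne'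
    simp only [arctanPowPartialSum]
    rw [Finset.sum_div]
    refine Finset.sum_congr rfl fun n _ => ?_
    rcases lt_or_ge n r with h | h
    · simp [nestedSum_eq_zero_of_lt h]
    · rw [show 2 * n + 1 - r = 2 * n - r + 1 by omega, pow_succ]
      field_simp
  have hc : Continuous (fun x : ℝ => ∑ n ∈ Finset.range N,
        (-1) ^ (n + r) * (nestedSum r n / (2 * n + 1 - r)) * x ^ (2 * n - r)) := by
    fun_prop
  refine ⟨(hc.intervalIntegrable 0 1).congr heq, ?_⟩
  rw [← intervalIntegral.integral_congr_ae (.of_forall fun _ hx => heq hx), intervalIntegral.integral_finsetSum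
    fun n _ => Continuous.intervalIntegrable (by fun_prop) _ _]
  refine Finset.sum_congr rfl fun n _ => ?_
  rw [intervalIntegral.integral_const_mul, integral_pow]
  rcases lt_or_ge n r with h | h
  · simp [nestedSum_eq_zero_of_lt h]
  · rw [Nat.cast_sub (by omega)]
    push_cast
    rw [one_pow, zero_pow (by omega), show (2 * n - r + 1 : ℝ) = 2 * n + 1 - r by ring]
    ring

/-- Splitting a sum over strictly decreasing tuples according to the leading entry. -/
lemma sum_strictAnti_succ (r N : ℕ) (G : (Fin (r + 1) → ℕ) → ℝ) :
    ∑ f ∈ (Fintype.piFinset fun _ : Fin (r + 1) => Finset.Icc 1 N).filter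
        (fun f => StrictAnti f), G f =
      ∑ n ∈ Finset.range N, ∑ f ∈ (Fintype.piFinset fun _ : Fin r => Finset.Icc 1 n).filter
        (fun f => StrictAnti f), G (Fin.cons (n + 1) f) := by
  rw [Finset.sum_sigma']
  symm
  refine Finset.sum_bij' (fun p _ => Fin.cons (p.1 + 1) p.2)
    (fun f _ => ⟨f 0 - 1, Fin.tail f⟩) ?_ ?_ ?_ ?_ ?_
  · rintro ⟨n, f⟩ h
    simp only [Finset.mem_sigma, Finset.mem_range, Finset.mem_filter, Fintype.mem_piFinset,
      Finset.mem_Icc] at h ⊢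
    obtain ⟨hn, hf, hanti⟩ := h
    refine ⟨fun i => ?_, ?_⟩
    · refine Fin.cases (by simpa using hn) (fun i => ?_) i
      have := hf i
      simp only [Fin.cons_succ]
      omega
    · intro i j
      refine Fin.cases ?_ (fun j => ?_) j
      · intro h
        exact absurd h (Fin.not_lt_zero i)
      · refine Fin.cases (fun _ => ?_) (fun i h => ?_) i
        · have := hf j
          simp only [Fin.cons_succ, Fin.cons_zero]
          omega
        · simpa using hanti (Fin.succ_lt_succ_iff.1 h)
  · intro f h
    simp only [Finset.mem_sigma, Finset.mem_range, Finset.mem_filter, Fintype.mem_piFinset,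
      Finset.mem_Icc] at h ⊢
    obtain ⟨hf, hanti⟩ := h
    refine ⟨by have := hf 0; omega, fun i => ?_, fun i j hij =>
      hanti (Fin.succ_lt_succ_iff.2 hij)⟩
    have h1 := hf i.succ
    have h2 := hanti (Fin.succ_pos i)
    simp only [Fin.tail]
    omega
  · rintro ⟨n, f⟩ _
    simp
  · intro f h
    simp only [Finset.mem_filter, Fintype.mem_piFinset, Finset.mem_Icc] at h
    have := (h.1 0).1
    simp only [Nat.sub_add_cancel this, Fin.cons_self_tail]
  · intros
    rfl

lemma prod_cons_factor (r n : ℕ) (f : Fin r → ℕ) :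
    ∏ i : Fin (r + 1), (2 * ((Fin.cons (n + 1) f : Fin (r + 1) → ℕ) i : ℝ) -
        ((r + 1 : ℕ) : ℝ) + (i : ℕ)) =
      (2 * n + 1 - r) * ∏ i : Fin r, (2 * (f i : ℝ) - (r : ℝ) + (i : ℕ)) := by
  rw [Fin.prod_univ_succ]
  congr 1
  · simp only [Fin.cons_zero, Fin.val_zero]
    push_cast
    ring
  · refine Finset.prod_congr rfl fun i _ => ?_
    simp only [Fin.cons_succ, Fin.val_succ]
    push_cast
    ring

lemma sum_strictAnti_inv_prod (r N : ℕ) :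
    ∑ f ∈ (Fintype.piFinset fun _ : Fin r => Finset.Icc 1 N).filter (fun f => StrictAnti f),
      (∏ i : Fin r, (2 * (f i : ℝ) - (r : ℝ) + (i : ℕ)))⁻¹ = nestedSum r N := by
  induction r generalizing N with
  | zero => simp [nestedSum, Finset.filter_true_of_mem, Subsingleton.strictAnti]
  | succ r ih =>
    rw [sum_strictAnti_succ, nestedSum]
    refine Finset.sum_congr rfl fun n _ => ?_
    rw [← ih n, Finset.sum_div]
    refine Finset.sum_congr rfl fun f _ => ?_
    rw [prod_cons_factor, mul_inv]
    ring

/-- For `r ≥ 1`,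
`∫₀¹ arctan(x)^r/x dx = r!·∑_{n₁>⋯>n_r>0} (−1)^{n₁−r}/((2n₁−r)²·∏_{j=2}^{r}(2n_j−r+j−1))`,
the sum being taken as a limit of partial sums truncated by the bound `N` on all indices.
A tuple is encoded as a strictly decreasing function `f : Fin r → ℕ` with values in
`[1, N]`; the `j`-th factor (with `j = i + 1`) is `2·f i − r + i`, the first factor
appearing squared. -/
theorem integral_arctan_pow_div_x_eq_series (r : ℕ) (hr : 0 < r) :
    Tendsto (fun N : ℕ =>
        (Nat.factorial r : ℝ) *
          ∑ f ∈ (Fintype.piFinset fun _ : Fin r => Finset.Icc 1 N).filter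
              (fun f => StrictAnti f),
            (-1 : ℝ) ^ (f ⟨0, hr⟩ + r) /
              ((2 * (f ⟨0, hr⟩ : ℝ) - (r : ℝ)) *
                ∏ i : Fin r, (2 * (f i : ℝ) - (r : ℝ) + (i : ℕ))))
      atTop (nhds (∫ x in (0:ℝ)..1, Real.arctan x ^ r / x)) := by
  obtain ⟨r, rfl⟩ : ∃ s, r = s + 1 := ⟨r - 1, by omega⟩
  have hzero : (⟨0, hr⟩ : Fin (r + 1)) = 0 := rfl
  have hfac : ((r + 1).factorial : ℝ) ≠ 0 := by positivity
  have hsum : ∀ N : ℕ,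
      ∑ f ∈ (Fintype.piFinset fun _ : Fin (r + 1) => Finset.Icc 1 N).filter
          (fun f => StrictAnti f),
        (-1 : ℝ) ^ (f ⟨0, hr⟩ + (r + 1)) /
          ((2 * (f ⟨0, hr⟩ : ℝ) - ((r + 1 : ℕ) : ℝ)) *
            ∏ i : Fin (r + 1), (2 * (f i : ℝ) - ((r + 1 : ℕ) : ℝ) + (i : ℕ))) =
      ∫ x in (0 : ℝ)..1, arctanPowPartialSum (r + 1) N x / x := by
    intro N
    rw [(integral_arctanPowPartialSum_succ_div r N).2, sum_strictAnti_succ]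
    refine Finset.sum_congr rfl fun n _ => ?_
    rw [← sum_strictAnti_inv_prod, Finset.sum_div, Finset.mul_sum]
    refine Finset.sum_congr rfl fun f _ => ?_
    rw [prod_cons_factor, hzero, Fin.cons_zero]
    rw [show n + 1 + (r + 1) = n + r + 2 by ring, pow_add, neg_one_sq, mul_one,
      show (2 * ((n + 1 : ℕ) : ℝ) - ((r + 1 : ℕ) : ℝ)) = 2 * n + 1 - r by push_cast; ring]
    simp only [div_eq_mul_inv, mul_inv]
    ring
  simp only [hsum]
  obtain ⟨ε, hε, hb⟩ := exists_tendsto_zero_abs_arctanPowPartialSum_sub_le (r + 1)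
  have hlim : Tendsto (fun N => ∫ x in (0 : ℝ)..1, arctanPowPartialSum (r + 1) N x / x) atTop
      (nhds ((∫ x in (0 : ℝ)..1, arctan x ^ (r + 1) / x) / (r + 1).factorial)) := by
    rw [tendsto_iff_norm_sub_tendsto_zero]
    refine squeeze_zero' (Eventually.of_forall fun _ => norm_nonneg _) ?_ hε
    filter_upwards [hb] with N hN
    rw [← intervalIntegral.integral_div, ← intervalIntegral.integral_sub
      (integral_arctanPowPartialSum_succ_div r N).1
      ((intervalIntegrable_arctan_pow_succ_div r 0 1).div_const _)]
    have := intervalIntegral.norm_integral_le_of_norm_le_const (a := (0 : ℝ)) (b := 1) (C := ε N)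
      (f := fun x => arctanPowPartialSum (r + 1) N x / x -
        arctan x ^ (r + 1) / x / (r + 1).factorial) ?_
    · simpa using this
    · intro x hx
      rw [Set.uIoc_of_le zero_le_one] at hx
      rw [div_right_comm, ← sub_div, norm_div, Real.norm_eq_abs, Real.norm_eq_abs,
        abs_of_pos hx.1, div_le_iff₀ hx.1]
      exact hN x ⟨hx.1.le, hx.2⟩
  simpa [mul_div_cancel₀ _ hfac] using hlim.const_mul ((r + 1).factorial : ℝ)
end
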